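/- The CCR heat flow is pure: for the CP semigroup φ_t on B(H) with φ_t(W_z) = e^{−t|z|²}W_z (irreducible Weyl system), and any two normal states ρ₁, ρ₂ of B(H), one has ‖ρ₁∘φ_t − ρ₂∘φ_t‖ → 0 as t → ∞. -/

import Mathlib

open MeasureTheory Complex Filter
open scoped ComplexOrder

noncomputable section

/-- The symplectic form `ω((x,y),(x',y')) = (x'y − xy')/2` on `ℝ²`. -/
def symp (z w : ℝ × ℝ) : ℝ := (w.1 * z.2 - z.1 * w.2) / 2

variable (H : Type) [NormedAddCommGroup H] [InnerProductSpace ℂ H] [CompleteSpace H]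

/-- A Weyl system: a strongly continuous family of unitaries satisfying the Weyl relation. -/
structure WeylSystem where
  W : ℝ × ℝ → H →L[ℂ] H
  unitary_mem : ∀ z, W z ∈ unitary (H →L[ℂ] H)
  strong_cont : ∀ f : H, Continuous fun z => W z f
  weyl : ∀ z₁ z₂, W z₁ * W z₂ = Complex.exp (Complex.I * (symp z₁ z₂ : ℂ)) • W (z₁ + z₂)

variable {H}

/-- Irreducibility: any operator commuting with all the `W z` is a scalar. -/
def WeylSystem.Irreducible (S : WeylSystem H) : Prop :=
  ∀ T : H →L[ℂ] H, (∀ z, T * S.W z = S.W z * T) → ∃ c : ℂ, T = c • (1 : H →L[ℂ] H)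

/-- Conjugation `A ↦ W_{ζ/√2} A W_{ζ/√2}*`. -/
def WeylSystem.conj (S : WeylSystem H) (ζ : ℝ × ℝ) (A : H →L[ℂ] H) : H →L[ℂ] H :=
  S.W ((Real.sqrt 2)⁻¹ • ζ) * A * star (S.W ((Real.sqrt 2)⁻¹ • ζ))

/-- Normal (weak-* continuous) linear functionals on `B(H)`. -/
def IsNormalFunctional (ρ : (H →L[ℂ] H) → ℂ) : Prop :=
  ∃ ξ η : ℕ → H, Summable (fun n => ‖ξ n‖ * ‖η n‖) ∧
    ∀ A : H →L[ℂ] H, ρ A = ∑' n, @inner ℂ _ _ (A (ξ n)) (η n)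

/-- Normal states on `B(H)`. -/
def IsNormalState (ρ : (H →L[ℂ] H) → ℂ) : Prop :=
  IsNormalFunctional ρ ∧ (∀ A : H →L[ℂ] H, 0 ≤ ρ (star A * A)) ∧ ρ 1 = 1

/-- The norm of a (bounded) linear functional on `B(H)`. -/
def funcNorm (ρ : (H →L[ℂ] H) → ℂ) : ℝ :=
  ⨆ A : {A : H →L[ℂ] H // ‖A‖ ≤ 1}, ‖ρ A.1‖

/-- The Gaussian probability measure `μ_t` on `ℝ²`, with density `(πt)⁻¹ e^{−(x²+y²)/(4t)}`,
whose symplectic Fourier transform is `e^{−t|z|²}`. -/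
def gaussMeasure (t : ℝ) : Measure (ℝ × ℝ) :=
  volume.withDensity fun p => ENNReal.ofReal ((Real.pi * t)⁻¹ * Real.exp (-(p.1 ^ 2 + p.2 ^ 2) / (4 * t)))

/-- `Φ` is the CCR heat flow semigroup: `Φ 0` is the identity and for `t > 0`, `Φ t` is given by
the weak integral `Φ t A = ∫ W_{ζ/√2} A W_{ζ/√2}* dμ_t(ζ)` against the Gaussian measure. -/
def IsHeatFlow (S : WeylSystem H) (Φ : ℝ → (H →L[ℂ] H) → (H →L[ℂ] H)) : Prop :=
  Φ 0 = id ∧ ∀ t > 0, ∀ (A : H →L[ℂ] H) (ξ η : H),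
    @inner ℂ _ _ ((Φ t A) ξ) η = ∫ ζ, @inner ℂ _ _ ((S.conj ζ A) ξ) η ∂(gaussMeasure t)

/-- The density of `gaussMeasure 1`. -/
def gaussDensity (u : ℝ × ℝ) : ℝ := Real.pi⁻¹ * Real.exp (-(u.1 ^ 2 + u.2 ^ 2) / 4)

lemma continuous_gaussDensity : Continuous gaussDensity := by
  unfold gaussDensity; fun_prop

lemma gaussDensity_nonneg (u : ℝ × ℝ) : 0 ≤ gaussDensity u := by
  unfold gaussDensity; positivity

lemma integrable_exp_neg_mul_sq_add_sq {b : ℝ} (hb : 0 < b) :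
    Integrable fun u : ℝ × ℝ => Real.exp (-b * (u.1 ^ 2 + u.2 ^ 2)) := by
  have h := (integrable_exp_neg_mul_sq hb).mul_prod (integrable_exp_neg_mul_sq hb)
  refine h.congr (ae_of_all _ fun u => ?_)
  simp only [← Real.exp_add]
  ring_nf

lemma integrable_gaussDensity : Integrable gaussDensity := by
  refine ((integrable_exp_neg_mul_sq_add_sq (b := 1 / 4) (by norm_num)).const_mul
    Real.pi⁻¹).congr (ae_of_all _ fun u => ?_)
  simp only [gaussDensity]
  ring_nf

/-- Integrals against `gaussMeasure t` are rescaled integrals against `gaussMeasure 1`. -/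
lemma integral_gaussMeasure {t : ℝ} (ht : 0 < t) (F : ℝ × ℝ → ℂ) :
    ∫ ζ, F ζ ∂(gaussMeasure t) = ∫ u, gaussDensity u • F (Real.sqrt t • u) := by
  have hmeas : Measurable fun p : ℝ × ℝ =>
      ENNReal.ofReal ((Real.pi * t)⁻¹ * Real.exp (-(p.1 ^ 2 + p.2 ^ 2) / (4 * t))) := by
    fun_prop
  rw [gaussMeasure, integral_withDensity_eq_integral_toReal_smul hmeas
    (ae_of_all _ fun _ => ENNReal.ofReal_lt_top)]
  have hs : (Real.sqrt t) ^ 2 = t := Real.sq_sqrt ht.le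
  have key := Measure.integral_comp_smul (volume : Measure (ℝ × ℝ)) (fun p : ℝ × ℝ =>
    (ENNReal.ofReal ((Real.pi * t)⁻¹ *
      Real.exp (-(p.1 ^ 2 + p.2 ^ 2) / (4 * t)))).toReal • F p) (Real.sqrt t)
  have hfin : Module.finrank ℝ (ℝ × ℝ) = 2 := by simp
  rw [hfin, hs, abs_of_pos (inv_pos.2 ht)] at key
  rw [← smul_inv_smul₀ ht.ne' (∫ p : ℝ × ℝ, _ • F p), ← key, ← integral_smul]
  refine integral_congr_ae (ae_of_all _ fun u => ?_)
  have hexp : -((Real.sqrt t * u.1) ^ 2 + (Real.sqrt t * u.2) ^ 2) / (4 * t)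
      = -(u.1 ^ 2 + u.2 ^ 2) / 4 := by
    rw [mul_pow, mul_pow, hs]; field_simp
  simp only [Prod.smul_fst, Prod.smul_snd, smul_eq_mul]
  rw [hexp, ENNReal.toReal_ofReal (by positivity), smul_smul]
  congr 1
  simp only [gaussDensity]
  field_simp

/-- Translation is continuous in `L¹` at the Gaussian density. -/
lemma tendsto_integral_gaussDensity_translate :
    Tendsto (fun v : ℝ × ℝ => ∫ u, ‖gaussDensity (u + v) - gaussDensity u‖)
      (nhds 0) (nhds 0) := by
  have hlim := tendsto_integral_filter_of_dominated_convergence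
    (μ := (volume : Measure (ℝ × ℝ))) (l := nhds (0 : ℝ × ℝ))
    (F := fun v u => ‖gaussDensity (u + v) - gaussDensity u‖) (f := fun _ => (0 : ℝ))
    (fun u => Real.pi⁻¹ * Real.exp 1 * Real.exp (-(1 / 8) * (u.1 ^ 2 + u.2 ^ 2))
      + gaussDensity u) ?_ ?_ ?_ ?_
  · simpa using hlim
  · refine Eventually.of_forall fun v => Continuous.aestronglyMeasurable ?_
    exact ((continuous_gaussDensity.comp (continuous_id.add continuous_const)).sub
      continuous_gaussDensity).norm
  · filter_upwards [Metric.ball_mem_nhds (0 : ℝ × ℝ) one_pos] with v hv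
    refine ae_of_all _ fun u => ?_
    rw [mem_ball_zero_iff, Prod.norm_def, max_lt_iff, Real.norm_eq_abs, Real.norm_eq_abs] at hv
    have h1 : v.1 ^ 2 ≤ 1 := by
      have := abs_le.1 hv.1.le; nlinarith
    have h2 : v.2 ^ 2 ≤ 1 := by
      have := abs_le.1 hv.2.le; nlinarith
    rw [norm_norm]
    refine (norm_sub_le _ _).trans ?_
    rw [Real.norm_of_nonneg (gaussDensity_nonneg _), Real.norm_of_nonneg (gaussDensity_nonneg _)]
    refine add_le_add_left ?_ _
    rw [gaussDensity, mul_assoc, ← Real.exp_add]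
    refine mul_le_mul_of_nonneg_left (Real.exp_le_exp.2 ?_) (by positivity)
    simp only [Prod.fst_add, Prod.snd_add]
    nlinarith [sq_nonneg (u.1 + 2 * v.1), sq_nonneg (u.2 + 2 * v.2)]
  · exact ((integrable_exp_neg_mul_sq_add_sq (by norm_num)).const_mul _).add
      integrable_gaussDensity
  · refine ae_of_all _ fun u => ?_
    have hc : Continuous fun v : ℝ × ℝ => ‖gaussDensity (u + v) - gaussDensity u‖ :=
      ((continuous_gaussDensity.comp (continuous_const.add continuous_id)).sub
        continuous_const).norm
    simpa using hc.tendsto 0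

/-- A bounded function integrates to at most its bound times the total mass of `gaussMeasure t`,
which does not depend on `t`. -/
lemma norm_integral_gaussMeasure_le {t : ℝ} (ht : 0 < t) {F : ℝ × ℝ → ℂ} {C : ℝ}
    (hC : ∀ ζ, ‖F ζ‖ ≤ C) :
    ‖∫ ζ, F ζ ∂(gaussMeasure t)‖ ≤ (∫ u, gaussDensity u) * C := by
  rw [integral_gaussMeasure ht, ← integral_mul_const]
  refine norm_integral_le_of_norm_le (integrable_gaussDensity.mul_const C) (ae_of_all _ fun u => ?_)
  rw [norm_smul, Real.norm_of_nonneg (gaussDensity_nonneg u)]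
  exact mul_le_mul_of_nonneg_left (hC _) (gaussDensity_nonneg u)

/-- `gaussMeasure t` is almost translation invariant, in total variation. -/
lemma norm_integral_translate_sub_le {t : ℝ} (ht : 0 < t) {F : ℝ × ℝ → ℂ} (hF : Continuous F)
    {C : ℝ} (hC : ∀ ζ, ‖F ζ‖ ≤ C) (w : ℝ × ℝ) :
    ‖∫ ζ, F (ζ - w) ∂(gaussMeasure t) - ∫ ζ, F ζ ∂(gaussMeasure t)‖ ≤
      (∫ u, ‖gaussDensity (u + (Real.sqrt t)⁻¹ • w) - gaussDensity u‖) * C := by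
  have hst : Real.sqrt t ≠ 0 := (Real.sqrt_pos.2 ht).ne'
  set v := (Real.sqrt t)⁻¹ • w with hv
  have hw : Real.sqrt t • v = w := by rw [hv, smul_inv_smul₀ hst]
  have hFs : Continuous fun u : ℝ × ℝ => F (Real.sqrt t • u) :=
    hF.comp (continuous_const_smul _)
  have hint : ∀ g : ℝ × ℝ → ℝ, Integrable g →
      Integrable fun u => g u • F (Real.sqrt t • u) := fun g hg => by
    exact hg.smul_bdd C hFs.aestronglyMeasurable (ae_of_all _ fun u => hC _)
  have hG := integrable_gaussDensity
  have hGv : Integrable fun u => gaussDensity (u + v) := hG.comp_add_right v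
  have htr : ∫ u, gaussDensity u • F (Real.sqrt t • u - w) =
      ∫ u, gaussDensity (u + v) • F (Real.sqrt t • u) := by
    rw [← integral_add_right_eq_self _ v]
    simp [smul_add, hw]
  rw [integral_gaussMeasure ht, integral_gaussMeasure ht, htr,
    ← integral_sub (hint _ hGv) (hint _ hG), ← integral_mul_const]
  refine norm_integral_le_of_norm_le ((hGv.sub hG).norm.mul_const C) (ae_of_all _ fun u => ?_)
  rw [← sub_smul, norm_smul]
  exact mul_le_mul_of_nonneg_left (hC _) (norm_nonneg _)

namespace WeylSystem

variable (S : WeylSystem H)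

lemma star_mul_self (z : ℝ × ℝ) : star (S.W z) * S.W z = 1 :=
  Unitary.star_mul_self_of_mem (S.unitary_mem z)

lemma mul_star_self (z : ℝ × ℝ) : S.W z * star (S.W z) = 1 :=
  Unitary.mul_star_self_of_mem (S.unitary_mem z)

lemma W_zero : S.W 0 = 1 := by
  have h := S.weyl 0 0
  simp only [symp, Prod.fst_zero, mul_zero, sub_self, zero_div, ofReal_zero, Complex.exp_zero,
    add_zero, one_smul] at h
  calc S.W 0 = star (S.W 0) * (S.W 0 * S.W 0) := by
        rw [← mul_assoc, S.star_mul_self, one_mul]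
    _ = 1 := by rw [h, S.star_mul_self]

lemma star_W (z : ℝ × ℝ) : star (S.W z) = S.W (-z) := by
  have h := S.weyl z (-z)
  have h0 : symp z (-z) = 0 := by simp [symp]
  rw [h0, add_neg_cancel, S.W_zero] at h
  simp only [ofReal_zero, mul_zero, Complex.exp_zero, one_smul] at h
  calc star (S.W z) = star (S.W z) * (S.W z * S.W (-z)) := by rw [h, mul_one]
    _ = S.W (-z) := by rw [← mul_assoc, S.star_mul_self, one_mul]

lemma norm_W_apply (z : ℝ × ℝ) (ξ : H) : ‖S.W z ξ‖ = ‖ξ‖ :=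
  ContinuousLinearMap.norm_map_of_mem_unitary (S.unitary_mem z) ξ

lemma inner_W_apply (z : ℝ × ℝ) (ξ η : H) : inner ℂ (S.W z ξ) η = inner ℂ ξ (S.W (-z) η) := by
  rw [← S.star_W, ContinuousLinearMap.star_eq_adjoint, ContinuousLinearMap.adjoint_inner_right]

lemma inner_conj_apply (ζ : ℝ × ℝ) (A : H →L[ℂ] H) (ξ η : H) :
    inner ℂ (S.conj ζ A ξ) η =
      inner ℂ (A (S.W (-((Real.sqrt 2)⁻¹ • ζ)) ξ)) (S.W (-((Real.sqrt 2)⁻¹ • ζ)) η) := by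
  rw [conj, S.star_W, mul_apply_eq_comp, mul_apply_eq_comp,
    S.inner_W_apply]

lemma continuous_inner_conj (A : H →L[ℂ] H) (ξ η : H) :
    Continuous fun ζ => (inner ℂ (S.conj ζ A ξ) η : ℂ) := by
  simp only [inner_conj_apply]
  have hW : ∀ f : H, Continuous fun ζ : ℝ × ℝ => S.W (-((Real.sqrt 2)⁻¹ • ζ)) f := fun f =>
    (S.strong_cont f).comp (by fun_prop)
  exact (A.continuous.comp (hW ξ)).inner (hW η)

lemma norm_inner_conj_le (ζ : ℝ × ℝ) (A : H →L[ℂ] H) (ξ η : H) :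
    ‖(inner ℂ (S.conj ζ A ξ) η : ℂ)‖ ≤ ‖A‖ * ‖ξ‖ * ‖η‖ := by
  rw [inner_conj_apply]
  refine (norm_inner_le_norm _ _).trans ?_
  rw [S.norm_W_apply]
  gcongr
  exact (A.le_opNorm _).trans_eq (by rw [S.norm_W_apply])

/-- Moving the vectors by a Weyl unitary translates the parameter of the conjugation. -/
lemma inner_conj_W_apply (ζ z : ℝ × ℝ) (A : H →L[ℂ] H) (ξ η : H) :
    inner ℂ (S.conj ζ A (S.W z ξ)) (S.W z η) =
      inner ℂ (S.conj (ζ - Real.sqrt 2 • z) A ξ) η := by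
  have h2 : Real.sqrt 2 ≠ 0 := by positivity
  have hz : -((Real.sqrt 2)⁻¹ • (ζ - Real.sqrt 2 • z)) = -((Real.sqrt 2)⁻¹ • ζ) + z := by
    rw [smul_sub, inv_smul_smul₀ h2]; abel
  rw [inner_conj_apply, inner_conj_apply, hz]
  set c := Complex.exp (Complex.I * (symp (-((Real.sqrt 2)⁻¹ • ζ)) z : ℂ)) with hc
  have hcn : (starRingEnd ℂ) c * c = 1 := by
    rw [← Complex.normSq_eq_conj_mul_self, Complex.normSq_eq_norm_sq, hc, mul_comm Complex.I,
      Complex.norm_exp_ofReal_mul_I]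
    simp
  have hW : ∀ f, S.W (-((Real.sqrt 2)⁻¹ • ζ)) (S.W z f) =
      c • S.W (-((Real.sqrt 2)⁻¹ • ζ) + z) f := fun f => by
    rw [← mul_apply_eq_comp, S.weyl, smul_apply]
  rw [hW, hW, map_smul, inner_smul_left,
    inner_smul_right, ← mul_assoc, hcn, one_mul]

end WeylSystem

lemma norm_inner_apply_le {E : Type*} [NormedAddCommGroup E] [InnerProductSpace ℂ E]
    (A : E →L[ℂ] E) (ξ η : E) :
    ‖(inner ℂ (A ξ) η : ℂ)‖ ≤ ‖ξ‖ * ‖η‖ * ‖A‖ := by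
  refine (norm_inner_le_norm _ _).trans ?_
  calc ‖A ξ‖ * ‖η‖ ≤ ‖A‖ * ‖ξ‖ * ‖η‖ := by gcongr; exact A.le_opNorm ξ
    _ = _ := by ring

/-- The vector functional `A ↦ ⟪A ξ, η⟫`. -/
def vectorFunctional (ξ η : H) : (H →L[ℂ] H) →L⋆[ℂ] ℂ :=
  LinearMap.mkContinuous
    { toFun := fun A => inner ℂ (A ξ) η
      map_add' := fun A B => by simp
      map_smul' := fun c A => by simp [mul_comm] }
    (‖ξ‖ * ‖η‖) fun A => norm_inner_apply_le A ξ η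

@[simp]
lemma vectorFunctional_apply (ξ η : H) (A : H →L[ℂ] H) :
    vectorFunctional ξ η A = inner ℂ (A ξ) η := rfl

lemma norm_vectorFunctional_le (ξ η : H) : ‖vectorFunctional ξ η‖ ≤ ‖ξ‖ * ‖η‖ :=
  LinearMap.mkContinuous_norm_le _ (by positivity) _

/-- `vectorFunctional` as a bounded sesquilinear map. -/
def vectorFunctionalSL : H →L⋆[ℂ] H →L[ℂ] ((H →L[ℂ] H) →L⋆[ℂ] ℂ) :=
  LinearMap.mkContinuous₂
    (LinearMap.mk₂'ₛₗ (starRingEnd ℂ) (RingHom.id ℂ) vectorFunctional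
      (fun ξ ξ' η => by ext A; simp)
      (fun c ξ η => by ext A; simp [mul_comm])
      (fun ξ η η' => by ext A; simp)
      (fun c ξ η => by ext A; simp))
    1 fun ξ η => by simpa using norm_vectorFunctional_le ξ η

@[simp]
lemma vectorFunctionalSL_apply (ξ η : H) :
    vectorFunctionalSL ξ η = vectorFunctional ξ η := rfl

lemma IsNormalFunctional.exists_hasSum {ρ : (H →L[ℂ] H) → ℂ} (h : IsNormalFunctional ρ) :
    ∃ (ξ η : ℕ → H) (f : (H →L[ℂ] H) →L⋆[ℂ] ℂ),
      HasSum (fun n => vectorFunctional (ξ n) (η n)) f ∧ ∀ A, f A = ρ A := by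
  obtain ⟨ξ, η, hsum, hρ⟩ := h
  have hs : Summable fun n => vectorFunctional (ξ n) (η n) :=
    Summable.of_norm_bounded hsum fun n => norm_vectorFunctional_le _ _
  refine ⟨ξ, η, _, hs.hasSum, fun A => ?_⟩
  have hA := hs.hasSum.mapL (ContinuousLinearMap.apply' ℂ (starRingEnd ℂ) A)
  rw [hρ]
  exact hA.tsum_eq.symm

/-- A point outside a closed subspace is separated from it by a continuous functional. -/
lemma Submodule.mem_of_isClosed_of_forall_dual {E : Type*} [NormedAddCommGroup E]
    [NormedSpace ℂ E] (M : Submodule ℂ E) (hM : IsClosed (M : Set E)) {x : E}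
    (hx : ∀ g : StrongDual ℂ E, (∀ m ∈ M, g m = 0) → g x = 0) : x ∈ M := by
  have := hM
  by_contra hxM
  have hne : ‖(M.mkQ x)‖ ≠ 0 := by
    rw [norm_ne_zero_iff, Submodule.mkQ_apply, Ne, Submodule.Quotient.mk_eq_zero]
    exact hxM
  obtain ⟨g, -, hg⟩ := exists_dual_vector ℂ _ hne
  have h := hx (g.comp M.mkQL) fun m hm => by
    have : M.mkQ m = 0 := (Submodule.Quotient.mk_eq_zero M).2 hm
    change g (M.mkQ m) = 0
    rw [this, map_zero]
  change g (M.mkQ x) = 0 at h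
  rw [hg] at h
  exact hne (Complex.ofReal_eq_zero.1 h)

section HeatFlow

variable {S : WeylSystem H} {Φ : ℝ → (H →L[ℂ] H) → (H →L[ℂ] H)}

lemma IsHeatFlow.norm_apply_le (hΦ : IsHeatFlow S Φ) {t : ℝ} (ht : 0 < t) (A : H →L[ℂ] H) :
    ‖Φ t A‖ ≤ (∫ u, gaussDensity u) * ‖A‖ := by
  have hM : 0 ≤ ∫ u, gaussDensity u := integral_nonneg gaussDensity_nonneg
  refine ContinuousLinearMap.opNorm_le_bound _ (by positivity) fun ξ => ?_
  have h := norm_integral_gaussMeasure_le ht fun ζ => S.norm_inner_conj_le ζ A ξ (Φ t A ξ)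
  rw [← hΦ.2 t ht, inner_self_eq_norm_sq_to_K, norm_pow, RCLike.norm_ofReal,
    abs_norm] at h
  rcases (norm_nonneg (Φ t A ξ)).eq_or_lt with h0 | hpos
  · rw [← h0]; positivity
  · refine le_of_mul_le_mul_right ?_ hpos
    nlinarith

/-- The functionals `f` with `‖f ∘ Φ t‖ → 0` as `t → ∞`. -/
def decayingFunctionals (Φ : ℝ → (H →L[ℂ] H) → (H →L[ℂ] H)) :
    Submodule ℂ ((H →L[ℂ] H) →L⋆[ℂ] ℂ) where
  carrier := {f | ∀ ε > 0, ∀ᶠ t in atTop, ∀ A : H →L[ℂ] H, ‖A‖ ≤ 1 → ‖f (Φ t A)‖ ≤ ε}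
  add_mem' := fun {f g} hf hg ε hε => by
    filter_upwards [hf (ε / 2) (half_pos hε), hg (ε / 2) (half_pos hε)] with t h1 h2 A hA
    exact ((norm_add_le _ _).trans (add_le_add (h1 A hA) (h2 A hA))).trans_eq (add_halves ε)
  zero_mem' := fun ε hε => Eventually.of_forall fun t A _ => by simpa using hε.le
  smul_mem' := fun c f hf ε hε => by
    have hc : 0 < ‖c‖ + 1 := by positivity
    filter_upwards [hf (ε / (‖c‖ + 1)) (div_pos hε hc)] with t h A hA
    have h' := h A hA
    rw [le_div_iff₀ hc] at h'
    change ‖c • f (Φ t A)‖ ≤ ε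
    rw [norm_smul]
    nlinarith [norm_nonneg (f (Φ t A))]

lemma mem_decayingFunctionals {f : (H →L[ℂ] H) →L⋆[ℂ] ℂ} :
    f ∈ decayingFunctionals Φ ↔
      ∀ ε > 0, ∀ᶠ t in atTop, ∀ A : H →L[ℂ] H, ‖A‖ ≤ 1 → ‖f (Φ t A)‖ ≤ ε := Iff.rfl

lemma IsHeatFlow.isClosed_decayingFunctionals (hΦ : IsHeatFlow S Φ) :
    IsClosed (decayingFunctionals Φ : Set ((H →L[ℂ] H) →L⋆[ℂ] ℂ)) := by
  refine isClosed_of_closure_subset fun f hf => ?_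
  rw [SetLike.mem_coe, mem_decayingFunctionals]
  intro ε hε
  set M := ∫ u, gaussDensity u
  have hM : 0 ≤ M := integral_nonneg gaussDensity_nonneg
  have hM1 : 0 < M + 1 := by positivity
  obtain ⟨g, hg, hfg⟩ := Metric.mem_closure_iff.1 hf (ε / 2 / (M + 1)) (by positivity)
  rw [dist_eq_norm, lt_div_iff₀ hM1] at hfg
  filter_upwards [mem_decayingFunctionals.1 hg (ε / 2) (half_pos hε), eventually_gt_atTop 0]
    with t hgt ht A hA
  have hΦA : ‖Φ t A‖ ≤ M := (hΦ.norm_apply_le ht A).trans (mul_le_of_le_one_right hM hA)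
  have h1 : ‖(f - g) (Φ t A)‖ ≤ ‖f - g‖ * M :=
    ((f - g).le_opNorm _).trans (mul_le_mul_of_nonneg_left hΦA (norm_nonneg _))
  have h2 : f (Φ t A) = (f - g) (Φ t A) + g (Φ t A) := by simp
  rw [h2]
  refine (norm_add_le _ _).trans ?_
  nlinarith [hgt A hA, norm_nonneg (f - g)]

lemma IsHeatFlow.vectorFunctional_sub_mem (hΦ : IsHeatFlow S Φ) (z : ℝ × ℝ) (ξ η : H) :
    vectorFunctional (S.W z ξ) (S.W z η) - vectorFunctional ξ η ∈ decayingFunctionals Φ := by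
  rw [mem_decayingFunctionals]
  intro ε hε
  have hv : Tendsto (fun t : ℝ => (Real.sqrt t)⁻¹ • (Real.sqrt 2 • z)) atTop (nhds 0) := by
    simpa using (tendsto_inv_atTop_zero.comp Real.tendsto_sqrt_atTop).smul_const
      (Real.sqrt 2 • z)
  have hlim := (tendsto_integral_gaussDensity_translate.comp hv).mul_const (‖ξ‖ * ‖η‖)
  rw [zero_mul] at hlim
  filter_upwards [hlim.eventually_le_const hε, eventually_gt_atTop 0] with t hle ht A hA
  have hC : ∀ ζ, ‖(inner ℂ (S.conj ζ A ξ) η : ℂ)‖ ≤ ‖ξ‖ * ‖η‖ := fun ζ => by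
    refine (S.norm_inner_conj_le ζ A ξ η).trans ?_
    rw [mul_assoc]
    exact mul_le_of_le_one_left (by positivity) hA
  have h := norm_integral_translate_sub_le ht (S.continuous_inner_conj A ξ η) hC (Real.sqrt 2 • z)
  simp only [← S.inner_conj_W_apply] at h
  rw [← hΦ.2 t ht, ← hΦ.2 t ht] at h
  exact h.trans hle

end HeatFlow

/-- A functional that is invariant under the Weyl unitaries is a multiple of evaluation at `1`. -/
lemma WeylSystem.Irreducible.exists_dual_vectorFunctional {S : WeylSystem H} (hS : S.Irreducible)
    (g : StrongDual ℂ ((H →L[ℂ] H) →L⋆[ℂ] ℂ))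
    (hg : ∀ z ξ η, g (vectorFunctional (S.W z ξ) (S.W z η)) = g (vectorFunctional ξ η)) :
    ∃ c : ℂ, ∀ ξ η, g (vectorFunctional ξ η) = c * vectorFunctional ξ η 1 := by
  set B : H →L⋆[ℂ] H →L[ℂ] ℂ :=
    (ContinuousLinearMap.compL ℂ H ((H →L[ℂ] H) →L⋆[ℂ] ℂ) ℂ g).comp vectorFunctionalSL
  set T := InnerProductSpace.continuousLinearMapOfBilin B
  have hT : ∀ ξ η, inner ℂ (T ξ) η = g (vectorFunctional ξ η) :=
    InnerProductSpace.continuousLinearMapOfBilin_apply B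
  obtain ⟨c, hc⟩ := hS T fun z => by
    ext ξ
    refine ext_inner_right ℂ fun η => ?_
    have hη : S.W z (S.W (-z) η) = η := by
      rw [← S.star_W, ← mul_apply_eq_comp, S.mul_star_self,
        one_apply_eq_self]
    rw [mul_apply_eq_comp, mul_apply_eq_comp, S.inner_W_apply, hT, hT,
      ← hg z ξ, hη]
  refine ⟨(starRingEnd ℂ) c, fun ξ η => ?_⟩
  rw [← hT, hc]
  simp [mul_comm]

/-- The CCR heat flow is pure: for the CP semigroup `φ_t` on `B(H)` with
`φ_t(W_z) = e^{−t|z|²} W_z` (realized as weak integrals against the Gaussian measures, for an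
irreducible Weyl system on a separable Hilbert space) and any two normal states `ρ₁, ρ₂`,
`‖ρ₁∘φ_t − ρ₂∘φ_t‖ → 0` as `t → ∞`. -/
theorem ccr_heat_flow_pure [TopologicalSpace.SeparableSpace H]
    (S : WeylSystem H) (hS : S.Irreducible)
    (Φ : ℝ → (H →L[ℂ] H) → (H →L[ℂ] H)) (hΦ : IsHeatFlow S Φ)
    (ρ₁ ρ₂ : (H →L[ℂ] H) → ℂ) (h₁ : IsNormalState ρ₁) (h₂ : IsNormalState ρ₂) :
    Tendsto (fun t : ℝ => funcNorm (fun A => ρ₁ (Φ t A) - ρ₂ (Φ t A))) atTop (nhds 0) := by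
  obtain ⟨ξ₁, η₁, f₁, hf₁, hρ₁⟩ := h₁.1.exists_hasSum
  obtain ⟨ξ₂, η₂, f₂, hf₂, hρ₂⟩ := h₂.1.exists_hasSum
  have hmem : f₁ - f₂ ∈ decayingFunctionals Φ := by
    refine Submodule.mem_of_isClosed_of_forall_dual _ hΦ.isClosed_decayingFunctionals
      fun g hg => ?_
    obtain ⟨c, hc⟩ := hS.exists_dual_vectorFunctional g fun z ξ η => by
      have h := hg _ (hΦ.vectorFunctional_sub_mem z ξ η)
      rwa [map_sub, sub_eq_zero] at h
    have hval : ∀ {ξ η : ℕ → H} {f : (H →L[ℂ] H) →L⋆[ℂ] ℂ},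
        HasSum (fun n => vectorFunctional (ξ n) (η n)) f → g f = c * f 1 := fun {ξ η f} hf => by
      have h1 := hf.mapL g
      have h2 := (hf.mapL (ContinuousLinearMap.apply' ℂ (starRingEnd ℂ) 1)).mul_left c
      simp only [hc] at h1
      exact h1.unique h2
    rw [map_sub, hval hf₁, hval hf₂, hρ₁, hρ₂, h₁.2.2, h₂.2.2, sub_self]
  rw [Metric.tendsto_nhds]
  intro ε hε
  filter_upwards [mem_decayingFunctionals.1 hmem (ε / 2) (half_pos hε)] with t ht
  have hnonneg : 0 ≤ funcNorm fun A => ρ₁ (Φ t A) - ρ₂ (Φ t A) :=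
    Real.iSup_nonneg fun _ => norm_nonneg _
  rw [Real.dist_eq, sub_zero, abs_of_nonneg hnonneg]
  have : Nonempty {A : H →L[ℂ] H // ‖A‖ ≤ 1} := ⟨⟨0, by simp⟩⟩
  refine lt_of_le_of_lt (ciSup_le fun A => ?_) (half_lt_self hε)
  simp only [← hρ₁, ← hρ₂]
  exact ht A.1 A.2
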